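/- arXiv:2310.05679 — 3 statements merged into one kernel-verified Lean document; each statement's English description precedes it below -/
import Mathlib

section
/- Let d = 3/10 and let g_d(ω) = ω·(d + d² − 3dω + ω²)/(d² + (1 − 2d)ω) be the Henrick mapping function. Then for every ω with 0 < ω < 3/10 one has ω < g_d(ω) < 6ω. -/
/-- The Henrick mapping function used in the WENO-M scheme. -/
noncomputable def henrickG (d ω : ℝ) : ℝ :=
  ω * (d + d ^ 2 - 3 * d * ω + ω ^ 2) / (d ^ 2 + (1 - 2 * d) * ω)

/-- For `d = 3/10` and every `ω` with `0 < ω < 3/10`, one has `ω < g_d(ω) < 6ω`. -/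
theorem stmt3 (ω : ℝ) (h0 : 0 < ω) (h1 : ω < 3 / 10) :
    ω < henrickG (3 / 10) ω ∧ henrickG (3 / 10) ω < 6 * ω := by
  have hD : 0 < (3 / 10 : ℝ) ^ 2 + (1 - 2 * (3 / 10)) * ω := by linarith
  unfold henrickG
  constructor
  · rw [lt_div_iff₀ hD]
    have h : 0 < ω * ((1 - ω) * (3 / 10 - ω)) :=
      mul_pos h0 (mul_pos (by linarith) (by linarith))
    linarith
  · rw [div_lt_iff₀ hD]
    have h : 0 < ω * (15 / 100 + 3 * ω + ω * (3 / 10 - ω)) :=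
      mul_pos h0 (by linarith [mul_pos h0 (sub_pos.mpr h1)])
    linarith
end

section
/- Let n be a natural number, V a real number, and for s = 1, …, n let v_s, d_s, ω_s be real numbers with ∑_s d_s = 1 and ∑_s ω_s = 1. Let C₁, C₂, C₃ ≥ 0 and h > 0, and assume |v_s − V| ≤ C₁h³ for every s, |∑_s d_s v_s − V| ≤ C₂h⁵, and |ω_s − d_s| ≤ C₃h² for every s. Then |∑_s ω_s v_s − V| ≤ (C₂ + n·C₁·C₃)h⁵. -/
open Finset

/-- Abstract accuracy lemma behind the sufficient condition `ω_s − d_s = O(Δx²)` for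
fifth-order accuracy of the WENO reconstruction. -/
theorem stmt11 (n : ℕ) (V : ℝ) (v d ω : Fin n → ℝ)
    (hd : ∑ s, d s = 1) (hω : ∑ s, ω s = 1)
    (C₁ C₂ C₃ : ℝ) (hC₁ : 0 ≤ C₁) (hC₂ : 0 ≤ C₂) (hC₃ : 0 ≤ C₃)
    (h : ℝ) (hh : 0 < h)
    (h1 : ∀ s, |v s - V| ≤ C₁ * h ^ 3)
    (h2 : |(∑ s, d s * v s) - V| ≤ C₂ * h ^ 5)
    (h3 : ∀ s, |ω s - d s| ≤ C₃ * h ^ 2) :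
    |(∑ s, ω s * v s) - V| ≤ (C₂ + n * C₁ * C₃) * h ^ 5 := by
  have key : (∑ s, ω s * v s) - V
      = ((∑ s, d s * v s) - V) + ∑ s, (ω s - d s) * (v s - V) := by
    simp only [sub_mul, mul_sub, sum_sub_distrib, ← sum_mul, hd, hω]
    ring
  have bound : |∑ s, (ω s - d s) * (v s - V)| ≤ n * (C₃ * h ^ 2 * (C₁ * h ^ 3)) := by
    calc |∑ s, (ω s - d s) * (v s - V)|
        ≤ ∑ s, |(ω s - d s) * (v s - V)| := abs_sum_le_sum_abs _ _
      _ ≤ ∑ _s : Fin n, C₃ * h ^ 2 * (C₁ * h ^ 3) := by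
          refine sum_le_sum fun s _ => ?_
          rw [abs_mul]
          exact mul_le_mul (h3 s) (h1 s) (abs_nonneg _) (by positivity)
      _ = n * (C₃ * h ^ 2 * (C₁ * h ^ 3)) := by simp
  rw [key]
  calc _ ≤ C₂ * h ^ 5 + n * (C₃ * h ^ 2 * (C₁ * h ^ 3)) :=
        (abs_add_le _ _).trans (add_le_add h2 bound)
    _ = (C₂ + n * C₁ * C₃) * h ^ 5 := by ring
end

section
/- Let v : ℝ → ℝ be six times continuously differentiable, x₀ ∈ ℝ, and suppose v′(x₀) ≠ 0. For h > 0 define the cell averages v̄_j(h), j = −2, …, 2, and the Jiang–Shu smoothness indicators β₀(h), β₁(h), β₂(h). Set d₀ = 1/10, d₁ = 3/5, d₂ = 3/10 and (with ε = 0) define the WENO-JS quantities α_s(h) = d_s/β_s(h)² and ω_s(h) = α_s(h)/(α₀(h) + α₁(h) + α₂(h)). Then there exists h₀ > 0 such that β_s(h) > 0 for all 0 < h < h₀ and s = 0, 1, 2, and for each s the difference ω_s(h) − d_s is O(h²) as h → 0⁺. -/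
open Filter Topology Asymptotics

/-- Cell average of `v` over the cell `[x₀+(j-1/2)h, x₀+(j+1/2)h]`. -/
noncomputable def cellAvg (v : ℝ → ℝ) (x₀ h j : ℝ) : ℝ :=
  (1 / h) * ∫ t in (x₀ + (j - 1 / 2) * h)..(x₀ + (j + 1 / 2) * h), v t

/-- The Jiang–Shu smoothness indicator `β₀`. -/
noncomputable def beta0 (v : ℝ → ℝ) (x₀ h : ℝ) : ℝ :=
  (13 / 12) * (cellAvg v x₀ h (-2) - 2 * cellAvg v x₀ h (-1) + cellAvg v x₀ h 0) ^ 2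
    + (1 / 4) * (cellAvg v x₀ h (-2) - 4 * cellAvg v x₀ h (-1) + 3 * cellAvg v x₀ h 0) ^ 2

/-- The Jiang–Shu smoothness indicator `β₁`. -/
noncomputable def beta1 (v : ℝ → ℝ) (x₀ h : ℝ) : ℝ :=
  (13 / 12) * (cellAvg v x₀ h (-1) - 2 * cellAvg v x₀ h 0 + cellAvg v x₀ h 1) ^ 2
    + (1 / 4) * (cellAvg v x₀ h (-1) - cellAvg v x₀ h 1) ^ 2

/-- The Jiang–Shu smoothness indicator `β₂`. -/
noncomputable def beta2 (v : ℝ → ℝ) (x₀ h : ℝ) : ℝ :=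
  (13 / 12) * (cellAvg v x₀ h 0 - 2 * cellAvg v x₀ h 1 + cellAvg v x₀ h 2) ^ 2
    + (1 / 4) * (3 * cellAvg v x₀ h 0 - 4 * cellAvg v x₀ h 1 + cellAvg v x₀ h 2) ^ 2

/-- The vector of Jiang–Shu smoothness indicators. -/
noncomputable def betaV (v : ℝ → ℝ) (x₀ h : ℝ) : Fin 3 → ℝ :=
  ![beta0 v x₀ h, beta1 v x₀ h, beta2 v x₀ h]

/-- The linear weights of the fifth-order WENO reconstruction at the right cell boundary. -/
noncomputable def dLin : Fin 3 → ℝ := ![1 / 10, 3 / 5, 3 / 10]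

/-- The WENO-JS nonlinear weights, with `ε = 0`, as functions of the smoothness indicators. -/
noncomputable def jsWeight (s : Fin 3) (q : Fin 3 → ℝ) : ℝ :=
  (dLin s / q s ^ 2) / ∑ r, dLin r / q r ^ 2

lemma jsWeight_div_const {c : ℝ} (hc : c ≠ 0) (s : Fin 3) (q : Fin 3 → ℝ) :
    jsWeight s (fun r => q r / c) = jsWeight s q := by
  have key : ∀ r, dLin r / (q r / c) ^ 2 = c ^ 2 * (dLin r / q r ^ 2) := fun r => by
    rw [div_pow, div_div_eq_mul_div, mul_comm, mul_div_assoc]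
  simp only [jsWeight, key, ← Finset.mul_sum]
  exact mul_div_mul_left _ _ (pow_ne_zero 2 hc)

lemma sum_dLin : ∑ r, dLin r = 1 := by
  simp [Fin.sum_univ_three, dLin]; norm_num

lemma jsWeight_const {c : ℝ} (hc : c ≠ 0) (s : Fin 3) : jsWeight s (fun _ => c) = dLin s := by
  simp only [jsWeight, ← Finset.sum_div, sum_dLin]
  field_simp

lemma differentiableAt_jsWeight {c : ℝ} (hc : c ≠ 0) (s : Fin 3) :
    DifferentiableAt ℝ (jsWeight s) (fun _ => c) := by
  have hterm : ∀ r : Fin 3, DifferentiableAt ℝ (fun q : Fin 3 → ℝ => dLin r / q r ^ 2)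
      (fun _ => c) := fun r => by
    have hr : DifferentiableAt ℝ (fun q : Fin 3 → ℝ => q r ^ 2) (fun _ => c) := by fun_prop
    simpa only [div_eq_mul_inv] using (hr.fun_inv (pow_ne_zero 2 hc)).const_mul (dLin r)
  have hsum : DifferentiableAt ℝ (fun q : Fin 3 → ℝ => ∑ r, dLin r / q r ^ 2) (fun _ => c) :=
    DifferentiableAt.fun_sum fun r _ => hterm r
  refine ((hterm s).mul (hsum.inv ?_)).congr_of_eventuallyEq
    (.of_forall fun q => div_eq_mul_inv _ _)
  rw [← Finset.sum_div, sum_dLin]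
  positivity

lemma Asymptotics.IsBigO.tendsto_div_sq {f : ℝ → ℝ} {a : ℝ}
    (hf : (fun h => f h / h ^ 2 - a) =O[𝓝[>] (0 : ℝ)] fun h => h ^ 2) :
    Tendsto (fun h => f h / h ^ 2) (𝓝[>] 0) (𝓝 a) := by
  refine tendsto_sub_nhds_zero_iff.1 (hf.trans_tendsto ?_)
  have : Tendsto (fun h : ℝ => h ^ 2) (𝓝 0) (𝓝 (0 ^ 2)) := (continuous_pow 2).tendsto 0
  simpa using this.mono_left nhdsWithin_le_nhds

lemma exists_quadratic_taylor_isBigO {v : ℝ → ℝ} (hv : ContDiff ℝ 3 v) (x₀ : ℝ) :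
    ∃ b : ℝ, (fun t => v t - (v x₀ + deriv v x₀ * (t - x₀) + b * (t - x₀) ^ 2))
      =O[𝓝 x₀] fun t => (t - x₀) ^ 3 := by
  refine ⟨iteratedDeriv 2 v x₀ / 2, ?_⟩
  have h := (taylor_isLittleO_univ (x₀ := x₀) (n := 3) hv).isBigO.add
    ((isBigO_refl (fun t : ℝ => (t - x₀) ^ 3) (𝓝 x₀)).const_mul_left (iteratedDeriv 3 v x₀ / 6))
  refine h.congr_left fun t => ?_
  simp [taylor_within_apply, iteratedDerivWithin_univ, Nat.factorial]
  ring

lemma isBigO_cellAvg {E : ℝ → ℝ} {x₀ : ℝ} (hE : E =O[𝓝 x₀] fun t => (t - x₀) ^ 3) (j : ℝ) :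
    (fun h => cellAvg E x₀ h j) =O[𝓝[>] (0 : ℝ)] fun h => h ^ 3 := by
  obtain ⟨C, hC0, hC⟩ := hE.exists_pos
  obtain ⟨δ, hδ, hball⟩ := Metric.eventually_nhds_iff.1 hC.bound
  have hM : 0 < |j| + 1 := by positivity
  refine IsBigO.of_bound (C * (|j| + 1) ^ 3) ?_
  filter_upwards [Ioo_mem_nhdsGT (show 0 < δ / (|j| + 1) by positivity)] with h hh
  obtain ⟨h0, h1⟩ := hh
  rw [lt_div_iff₀ hM] at h1
  have hle : x₀ + (j - 1 / 2) * h ≤ x₀ + (j + 1 / 2) * h := by nlinarith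
  have hint : ‖∫ t in (x₀ + (j - 1 / 2) * h)..(x₀ + (j + 1 / 2) * h), E t‖
      ≤ C * (h * (|j| + 1)) ^ 3 * |x₀ + (j + 1 / 2) * h - (x₀ + (j - 1 / 2) * h)| := by
    refine intervalIntegral.norm_integral_le_of_norm_le_const fun t ht => ?_
    rw [Set.uIoc_of_le hle] at ht
    have hj1 := mul_le_mul_of_nonneg_right (le_abs_self j) h0.le
    have hj2 := mul_le_mul_of_nonneg_right (neg_abs_le j) h0.le
    have habs : |t - x₀| ≤ h * (|j| + 1) := by
      rw [abs_le]
      constructor <;> linarith [ht.1, ht.2]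
    refine (hball (by rw [Real.dist_eq]; exact habs.trans_lt h1)).trans ?_
    rw [norm_pow, Real.norm_eq_abs]
    gcongr
  have hlen : x₀ + (j + 1 / 2) * h - (x₀ + (j - 1 / 2) * h) = h := by ring
  rw [hlen, abs_of_pos h0] at hint
  rw [cellAvg, norm_mul, norm_pow, Real.norm_of_nonneg h0.le,
    Real.norm_of_nonneg (by positivity : 0 ≤ 1 / h)]
  calc 1 / h * _ ≤ 1 / h * (C * (h * (|j| + 1)) ^ 3 * h) := by gcongr
    _ = C * (|j| + 1) ^ 3 * h ^ 3 := by field_simp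

lemma cellAvg_quadratic {h : ℝ} (hh : h ≠ 0) (x₀ j a c b : ℝ) :
    cellAvg (fun t => a + c * (t - x₀) + b * (t - x₀) ^ 2) x₀ h j
      = a + c * (j * h) + b * ((j ^ 2 + 1 / 12) * h ^ 2) := by
  have hderiv : ∀ t : ℝ, HasDerivAt
      (fun t => a * (t - x₀) + c / 2 * (t - x₀) ^ 2 + b / 3 * (t - x₀) ^ 3)
      (a + c * (t - x₀) + b * (t - x₀) ^ 2) t := fun t => by
    have h1 : HasDerivAt (fun t => t - x₀) 1 t := (hasDerivAt_id t).sub_const x₀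
    refine (((h1.const_mul a).add ((h1.pow 2).const_mul (c / 2))).add
      ((h1.pow 3).const_mul (b / 3))).congr_deriv ?_
    norm_num
    ring
  rw [cellAvg, intervalIntegral.integral_eq_sub_of_hasDerivAt (fun t _ => hderiv t)
    ((by fun_prop : Continuous _).intervalIntegrable _ _)]
  field_simp
  ring

lemma exists_cellAvg_isBigO {v : ℝ → ℝ} (hv : ContDiff ℝ 3 v) (x₀ : ℝ) :
    ∃ b : ℝ, ∀ j : ℝ, (fun h => cellAvg v x₀ h j
      - (v x₀ + deriv v x₀ * (j * h) + b * ((j ^ 2 + 1 / 12) * h ^ 2)))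
        =O[𝓝[>] (0 : ℝ)] fun h => h ^ 3 := by
  obtain ⟨b, hb⟩ := exists_quadratic_taylor_isBigO hv x₀
  refine ⟨b, fun j => (isBigO_cellAvg hb j).congr' ?_ EventuallyEq.rfl⟩
  filter_upwards [self_mem_nhdsWithin] with h hh
  have hh : 0 < h := hh
  rw [← cellAvg_quadratic hh.ne']
  simp only [cellAvg]
  rw [intervalIntegral.integral_sub (hv.continuous.intervalIntegrable _ _)
    ((by fun_prop : Continuous _).intervalIntegrable _ _), mul_sub]

lemma smoothness_div_sq_sub_isBigO {X Y : ℝ → ℝ} {k c : ℝ} (hk : k ^ 2 = 4 * c ^ 2)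
    (hX : X =O[𝓝[>] (0 : ℝ)] fun h => h ^ 2)
    (hY : (fun h => Y h - k * h) =O[𝓝[>] (0 : ℝ)] fun h => h ^ 3) :
    (fun h => ((13 / 12) * X h ^ 2 + (1 / 4) * Y h ^ 2) / h ^ 2 - c ^ 2)
      =O[𝓝[>] (0 : ℝ)] fun h => h ^ 2 := by
  have h31 : (fun h : ℝ => h ^ 3) =O[𝓝[>] (0 : ℝ)] fun h => h := by
    simpa using (isLittleO_pow_pow (𝕜 := ℝ) (show 1 < 3 by norm_num)).isBigO.mono
      (nhdsWithin_le_nhds (s := Set.Ioi 0))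
  have hYk : (fun h => Y h + k * h) =O[𝓝[>] (0 : ℝ)] fun h => h :=
    ((hY.trans h31).add ((isBigO_refl (fun h : ℝ => h) _).const_mul_left (2 * k))).congr_left
      fun h => by ring
  have hYY := ((hY.mul hYk).congr_right (g₂ := fun h => h ^ 4) fun h => by ring).const_mul_left
    (1 / 4)
  have hXX := ((hX.mul hX).congr_right (g₂ := fun h => h ^ 4) fun h => by ring).const_mul_left
    (13 / 12)
  have hsum := (hXX.add hYY).mul (isBigO_refl (fun h : ℝ => (h ^ 2)⁻¹) (𝓝[>] 0))
  refine hsum.congr' ?_ ?_ <;> filter_upwards [self_mem_nhdsWithin] with h hh <;>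
    have hh : h ≠ 0 := ne_of_gt hh
  · field_simp
    linear_combination (-12 * h ^ 2) * hk
  · field_simp

lemma betaV_div_sq_sub_isBigO {v : ℝ → ℝ} (hv : ContDiff ℝ 3 v) (x₀ : ℝ) (s : Fin 3) :
    (fun h => betaV v x₀ h s / h ^ 2 - deriv v x₀ ^ 2) =O[𝓝[>] (0 : ℝ)] fun h => h ^ 2 := by
  obtain ⟨b, hb⟩ := exists_cellAvg_isBigO hv x₀
  have h32 : (fun h : ℝ => h ^ 3) =O[𝓝[>] (0 : ℝ)] fun h => h ^ 2 :=
    (isLittleO_pow_pow (𝕜 := ℝ) (show 2 < 3 by norm_num)).isBigO.mono nhdsWithin_le_nhds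
  have hsq := (isBigO_refl (fun h : ℝ => h ^ 2) (𝓝[>] 0)).const_mul_left (2 * b)
  have comb : ∀ (p q r i j k : ℝ), (fun h => _) =O[𝓝[>] (0 : ℝ)] fun h => h ^ 3 :=
    fun p q r i j k => (((hb i).const_mul_left p).add ((hb j).const_mul_left q)).add
      ((hb k).const_mul_left r)
  fin_cases s
  · refine smoothness_div_sq_sub_isBigO (k := 2 * deriv v x₀) (by ring) ?_ ?_
    · exact (((comb 1 (-2) 1 (-2) (-1) 0).trans h32).add hsq).congr_left fun h => by ring
    · exact (comb 1 (-4) 3 (-2) (-1) 0).congr_left fun h => by ring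
  · refine smoothness_div_sq_sub_isBigO (k := -2 * deriv v x₀) (by ring) ?_ ?_
    · exact (((comb 1 (-2) 1 (-1) 0 1).trans h32).add hsq).congr_left fun h => by ring
    · exact (comb 1 0 (-1) (-1) 0 1).congr_left fun h => by ring
  · refine smoothness_div_sq_sub_isBigO (k := -2 * deriv v x₀) (by ring) ?_ ?_
    · exact (((comb 1 (-2) 1 0 1 2).trans h32).add hsq).congr_left fun h => by ring
    · exact (comb 3 (-4) 1 0 1 2).congr_left fun h => by ring

/-- At a non-critical point (`v′(x₀) ≠ 0`) of a `C⁶` function, the smoothness indicators are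
eventually positive and the WENO-JS nonlinear weights (with `ε = 0`) satisfy
`ω_s − d_s = O(h²)` as `h → 0⁺`. -/
theorem stmt15 (v : ℝ → ℝ) (hv : ContDiff ℝ 6 v) (x₀ : ℝ) (hx : deriv v x₀ ≠ 0) :
    ∃ h₀ : ℝ, 0 < h₀ ∧
      (∀ h : ℝ, 0 < h → h < h₀ → ∀ s : Fin 3, 0 < betaV v x₀ h s) ∧
      (∀ s : Fin 3,
        (fun h : ℝ =>
            (dLin s / (betaV v x₀ h s) ^ 2)
              / (∑ r : Fin 3, dLin r / (betaV v x₀ h r) ^ 2) - dLin s)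
          =O[𝓝[>] (0 : ℝ)] (fun h => h ^ 2)) := by
  have hβ := betaV_div_sq_sub_isBigO (hv.of_le (by norm_num)) x₀
  have hpos : ∀ᶠ h : ℝ in 𝓝[>] 0, ∀ s, 0 < betaV v x₀ h s := by
    refine eventually_all.2 fun s => ?_
    have hlim := (hβ s).tendsto_div_sq
    filter_upwards [hlim.eventually_const_lt (by positivity : 0 < deriv v x₀ ^ 2),
      self_mem_nhdsWithin] with h hh hh0
    have hh0 : 0 < h := hh0
    exact (div_pos_iff_of_pos_right (by positivity)).1 hh
  obtain ⟨h₀, hh₀, hsub⟩ := mem_nhdsGT_iff_exists_Ioo_subset.1 hpos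
  refine ⟨h₀, hh₀, fun h h1 h2 => hsub ⟨h1, h2⟩, fun s => ?_⟩
  have hlim : Tendsto (fun h r => betaV v x₀ h r / h ^ 2) (𝓝[>] 0)
      (𝓝 fun _ => deriv v x₀ ^ 2) :=
    tendsto_pi_nhds.2 fun r => (hβ r).tendsto_div_sq
  have hF := ((differentiableAt_jsWeight (pow_ne_zero 2 hx) s).isBigO_sub.comp_tendsto hlim).trans
    (isBigO_pi.2 hβ)
  refine hF.congr' ?_ EventuallyEq.rfl
  filter_upwards [self_mem_nhdsWithin] with h hh
  have hh : 0 < h := hh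
  simp only [Function.comp_apply, jsWeight_div_const (pow_ne_zero 2 hh.ne'),
    jsWeight_const (pow_ne_zero 2 hx)]
  rfl
end
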